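/- Let X be a random vector in ℝⁿ with density g and let p ≥ 1. Then vol(Z_p⁺(X)) ≥ 2^{n/p} 4^{−n} vol(Z_p(X)); in particular the volume radius satisfies vr(Z_p⁺(X)) ≥ (1/4) · 2^{1/p} vr(Z_p(X)). -/

import Mathlib

open MeasureTheory Real
open scoped RealInnerProductSpace Pointwise

/-- The `L_p`-centroid body of a density `g` on `ℝⁿ`. -/
noncomputable def ZpBody {n : ℕ} (g : EuclideanSpace ℝ (Fin n) → ℝ) (p : ℝ) :
    Set (EuclideanSpace ℝ (Fin n)) :=
  {x | ∀ y, ⟪x, y⟫ ≤ (∫ v, |⟪v, y⟫| ^ p * g v) ^ (1 / p)}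

/-- The one-sided `L_p`-centroid body of a density `g` on `ℝⁿ`. -/
noncomputable def ZpPlusBody {n : ℕ} (g : EuclideanSpace ℝ (Fin n) → ℝ) (p : ℝ) :
    Set (EuclideanSpace ℝ (Fin n)) :=
  {x | ∀ y, ⟪x, y⟫ ≤ (2 * ∫ v, (max ⟪v, y⟫ 0) ^ p * g v) ^ (1 / p)}

namespace ZpAux

variable {n : ℕ}

lemma compact_sub {K L : Set (EuclideanSpace ℝ (Fin n))} (hK : IsCompact K) (hL : IsCompact L) :
    IsCompact (K - L) := by
  rw [sub_eq_add_neg]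
  exact hK.add hL.neg

lemma half_inter {K : Set (EuclideanSpace ℝ (Fin n))} (hK : Convex ℝ K) {x : EuclideanSpace ℝ (Fin n)}
    (hx : x ∈ (1 / 2 : ℝ) • (K - K)) :
    ENNReal.ofReal ((1 / 2 : ℝ) ^ n) * volume K ≤ volume (K ∩ (x +ᵥ K)) := by
  obtain ⟨z, hz, rfl⟩ := hx
  obtain ⟨a, ha, b, hb, rfl⟩ := hz
  have h1 : volume (((1 / 2 : ℝ) • a) +ᵥ ((1 / 2 : ℝ) • K)) =
      ENNReal.ofReal ((1 / 2 : ℝ) ^ n) * volume K := by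
    rw [measure_vadd, Measure.addHaar_smul]
    simp
  rw [← h1]
  apply measure_mono
  rintro _ ⟨_, ⟨k, hk, rfl⟩, rfl⟩
  refine ⟨?_, ?_⟩
  · have := hK ha hk (a := 1 / 2) (b := 1 / 2) (by norm_num) (by norm_num) (by norm_num)
    simpa using this
  · have := hK hb hk (a := 1 / 2) (b := 1 / 2) (by norm_num) (by norm_num) (by norm_num)
    refine ⟨_, this, ?_⟩
    simp only [vadd_eq_add, smul_sub]
    abel

lemma lintegral_inter {K : Set (EuclideanSpace ℝ (Fin n))} (hK : MeasurableSet K) :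
    ∫⁻ x : EuclideanSpace ℝ (Fin n), volume (K ∩ (x +ᵥ K)) = volume K * volume K := by
  have h1 : ∀ x : EuclideanSpace ℝ (Fin n), volume (K ∩ (x +ᵥ K)) =
      ∫⁻ y, K.indicator 1 y * K.indicator (1 : (EuclideanSpace ℝ (Fin n)) → ENNReal) (y - x) := by
    intro x
    rw [← lintegral_indicator_one (hK.inter (hK.const_vadd x))]
    congr 1
    ext y
    have : y ∈ x +ᵥ K ↔ y - x ∈ K := by
      rw [Set.mem_vadd_set_iff_neg_vadd_mem, vadd_eq_add, neg_add_eq_sub]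
    by_cases h : y ∈ K <;> by_cases h' : y - x ∈ K <;> simp [Set.indicator, h, h', this]
  have hm : Measurable (K.indicator (1 : (EuclideanSpace ℝ (Fin n)) → ENNReal)) := measurable_one.indicator hK
  simp_rw [h1]
  rw [lintegral_lintegral_swap]
  · have h2 : ∀ y : EuclideanSpace ℝ (Fin n), ∫⁻ x, K.indicator 1 y * K.indicator (1 : (EuclideanSpace ℝ (Fin n)) → ENNReal) (y - x) =
        K.indicator 1 y * volume K := by
      intro y
      rw [lintegral_const_mul _ (by fun_prop),
        lintegral_sub_left_eq_self (fun z => K.indicator (1 : (EuclideanSpace ℝ (Fin n)) → ENNReal) z) y,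
        lintegral_indicator_one hK]
    simp_rw [h2]
    rw [lintegral_mul_const _ hm, lintegral_indicator_one hK]
  · apply Measurable.aemeasurable
    fun_prop

/-- Weak Rogers–Shephard inequality. -/
lemma rogers_shephard {K : Set (EuclideanSpace ℝ (Fin n))} (hK : Convex ℝ K) (hc : IsCompact K) (h0 : (0 : EuclideanSpace ℝ (Fin n)) ∈ K) :
    ENNReal.ofReal ((1 / 4 : ℝ) ^ n) * volume (K - K) ≤ volume K := by
  by_cases hz : volume K = 0
  · have hi : interior K = ∅ := by
      by_contra hne
      have hne' : (interior K).Nonempty := Set.nonempty_iff_ne_empty.mpr hne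
      have := isOpen_interior.measure_pos volume hne'
      exact absurd (measure_mono_null interior_subset hz) this.ne'
    have hspan : Submodule.span ℝ K ≠ ⊤ := by
      intro htop
      have h1 : affineSpan ℝ K = ⊤ := by
        rw [← AffineSubspace.direction_eq_top_iff_of_nonempty
          ((affineSpan_nonempty ℝ).mpr ⟨0, h0⟩), direction_affineSpan, vectorSpan_eq_span_vsub_set_right ℝ h0]
        simpa using htop
      have := (hK.interior_nonempty_iff_affineSpan_eq_top).mpr h1
      rw [hi] at this
      exact Set.not_nonempty_empty this
    have h2 : volume (K - K) = 0 := by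
      refine measure_mono_null ?_ (Measure.addHaar_submodule volume _ hspan)
      rintro _ ⟨a, ha, b, hb, rfl⟩
      exact Submodule.sub_mem _ (Submodule.subset_span ha) (Submodule.subset_span hb)
    simp [h2]
  · have hfin : volume K ≠ ⊤ := hc.measure_lt_top.ne
    have hD : MeasurableSet ((1 / 2 : ℝ) • (K - K)) :=
      ((compact_sub hc hc).smul (1 / 2 : ℝ)).measurableSet
    have h1 : ENNReal.ofReal ((1 / 2 : ℝ) ^ n) * volume K * volume ((1 / 2 : ℝ) • (K - K)) ≤
        volume K * volume K := by
      rw [← lintegral_inter hc.measurableSet, ← setLIntegral_const]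
      exact (setLIntegral_mono' hD fun x hx => half_inter hK hx).trans
        (setLIntegral_le_lintegral _ _)
    rw [Measure.addHaar_smul] at h1
    have h2 : ENNReal.ofReal ((1 / 4 : ℝ) ^ n) =
        ENNReal.ofReal ((1 / 2 : ℝ) ^ n) * ENNReal.ofReal ((1 / 2 : ℝ) ^ n) := by
      rw [← ENNReal.ofReal_mul (by positivity), ← mul_pow]
      norm_num
    have h3 : volume K * (ENNReal.ofReal ((1 / 4 : ℝ) ^ n) * volume (K - K)) ≤
        volume K * volume K := by
      refine le_trans (le_of_eq ?_) h1
      rw [h2]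
      have : |(1 / 2 : ℝ) ^ Module.finrank ℝ (EuclideanSpace ℝ (Fin n))| = (1 / 2 : ℝ) ^ n := by
        rw [finrank_euclideanSpace_fin, abs_of_nonneg (by positivity)]
      rw [this]
      ring
    exact (ENNReal.mul_le_mul_iff_right hz hfin).mp h3

/-- The body cut out by a sublinear function. -/
def body (f : (EuclideanSpace ℝ (Fin n)) → ℝ) : Set (EuclideanSpace ℝ (Fin n)) := {x | ∀ y, ⟪x, y⟫ ≤ f y}

lemma body_convex (f : (EuclideanSpace ℝ (Fin n)) → ℝ) : Convex ℝ (body f) := by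
  intro a ha b hb s t hs ht hst y
  rw [inner_add_left, inner_smul_left, inner_smul_left]
  have := mul_le_mul_of_nonneg_left (ha y) hs
  have h' := mul_le_mul_of_nonneg_left (hb y) ht
  have h3 : f y = s * f y + t * f y := by rw [← add_mul, hst, one_mul]
  simp only [conj_trivial]
  linarith

lemma body_compact (f : (EuclideanSpace ℝ (Fin n)) → ℝ) : IsCompact (body f) := by
  apply Metric.isCompact_of_isClosed_isBounded
  · have : body f = ⋂ y, {x | ⟪x, y⟫ ≤ f y} := by ext x; simp [body]
    rw [this]
    exact isClosed_iInter fun y => isClosed_le (by fun_prop) continuous_const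
  · rw [isBounded_iff_forall_norm_le]
    let e := EuclideanSpace.basisFun (Fin n) ℝ
    refine ⟨∑ i, max (f (e i)) (f (-(e i))), fun x hx => ?_⟩
    rw [← e.sum_repr x]
    refine (norm_sum_le _ _).trans (Finset.sum_le_sum fun i _ => ?_)
    rw [norm_smul, e.norm_eq_one, mul_one, e.repr_apply_apply, real_inner_comm, Real.norm_eq_abs,
      abs_le']
    refine ⟨(hx _).trans (le_max_left _ _), ?_⟩
    rw [← inner_neg_right]
    exact (hx _).trans (le_max_right _ _)

lemma exists_body (f : (EuclideanSpace ℝ (Fin n)) → ℝ) (hsm : ∀ c : ℝ, 0 < c → ∀ y, f (c • y) = c * f y)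
    (hadd : ∀ y z, f (y + z) ≤ f y + f z) (h0 : ∀ y, 0 ≤ f y) (y : EuclideanSpace ℝ (Fin n)) :
    ∃ x ∈ body f, f y ≤ ⟪x, y⟫ := by
  have f0 : f 0 = 0 := by
    have := hsm 2 (by norm_num) 0
    rw [smul_zero] at this
    linarith
  by_cases hy : y = 0
  · subst hy
    exact ⟨0, fun z => by simpa using h0 z, by simp [f0]⟩
  let φ : (EuclideanSpace ℝ (Fin n)) →ₗ.[ℝ] ℝ := LinearPMap.mkSpanSingleton y (f y) hy
  obtain ⟨g, hg1, hg2⟩ := exists_extension_of_le_sublinear φ f hsm hadd (by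
    rintro ⟨z, hz⟩
    obtain ⟨c, rfl⟩ := Submodule.mem_span_singleton.mp hz
    have : φ ⟨c • y, hz⟩ = c • f y := LinearPMap.mkSpanSingleton'_apply _ _ _ _ _
    rw [this]
    change c • f y ≤ f (c • y)
    rcases lt_trichotomy c 0 with hc | hc | hc
    · exact (mul_nonpos_of_nonpos_of_nonneg hc.le (h0 y)).trans (h0 _)
    · subst hc; simp [f0]
    · rw [hsm c hc, smul_eq_mul])
  refine ⟨(InnerProductSpace.toDual ℝ (EuclideanSpace ℝ (Fin n))).symm (LinearMap.toContinuousLinearMap g), ?_, ?_⟩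
  · intro z
    rw [InnerProductSpace.toDual_symm_apply]
    exact hg2 z
  · rw [InnerProductSpace.toDual_symm_apply]
    have h1 := hg1 ⟨y, Submodule.mem_span_singleton_self y⟩
    have h2 : φ ⟨y, Submodule.mem_span_singleton_self y⟩ = f y :=
      LinearPMap.mkSpanSingleton'_apply_self _ _ _ _
    change f y ≤ g y
    rw [← h2, ← h1]

lemma body_sub (f : (EuclideanSpace ℝ (Fin n)) → ℝ) (hsm : ∀ c : ℝ, 0 < c → ∀ y, f (c • y) = c * f y)
    (hadd : ∀ y z, f (y + z) ≤ f y + f z) (h0 : ∀ y, 0 ≤ f y) (x : EuclideanSpace ℝ (Fin n))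
    (hx : ∀ y, ⟪x, y⟫ ≤ f y + f (-y)) : x ∈ body f - body f := by
  by_contra hn
  have hc := compact_sub (body_compact f) (body_compact f)
  have hv := (body_convex f).sub (body_convex f)
  obtain ⟨L, u, hL1, hL2⟩ := geometric_hahn_banach_closed_point hv hc.isClosed hn
  set y := (InnerProductSpace.toDual ℝ (EuclideanSpace ℝ (Fin n))).symm L with hy
  have hLy : ∀ z, L z = ⟪z, y⟫ := fun z => by
    rw [real_inner_comm, hy, InnerProductSpace.toDual_symm_apply]
  obtain ⟨a, ha, ha'⟩ := exists_body f hsm hadd h0 y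
  obtain ⟨b, hb, hb'⟩ := exists_body f hsm hadd h0 (-y)
  have h1 := hL1 (a - b) (Set.sub_mem_sub ha hb)
  rw [hLy, inner_sub_left] at h1
  rw [hLy] at hL2
  rw [inner_neg_right] at hb'
  have := hx y
  linarith

end ZpAux

namespace ZpAux

variable {n : ℕ}

lemma rpow_wt {p : ℝ} (hp : 1 ≤ p) {a b : ℝ} (ha : 0 ≤ a) (hb : 0 ≤ b) :
    (a * b ^ (1 / p)) ^ p = a ^ p * b := by
  rw [Real.mul_rpow ha (by positivity), ← Real.rpow_mul hb, one_div_mul_cancel (by positivity),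
    Real.rpow_one]

/-- The one-sided weighted function. -/
noncomputable def phi (g : EuclideanSpace ℝ (Fin n) → ℝ) (p : ℝ) (y v : EuclideanSpace ℝ (Fin n)) :
    ℝ := max ⟪v, y⟫ 0 * g v ^ (1 / p)

lemma plus_integrable (g : EuclideanSpace ℝ (Fin n) → ℝ) (hg0 : ∀ x, 0 ≤ g x)
    (hgmeas : Measurable g) (p : ℝ) (hp : 1 ≤ p) (y : EuclideanSpace ℝ (Fin n))
    (hi : Integrable fun v => |⟪v, y⟫| ^ p * g v) :
    Integrable fun v => (max ⟪v, y⟫ 0) ^ p * g v := by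
  refine hi.mono' (by fun_prop) (Filter.Eventually.of_forall fun v => ?_)
  have h0 : 0 ≤ max ⟪v, y⟫ 0 := le_max_right _ _
  have := hg0 v
  rw [Real.norm_of_nonneg (by positivity)]
  gcongr
  exact max_le (le_abs_self _) (abs_nonneg _)

lemma phi_memLp (g : EuclideanSpace ℝ (Fin n) → ℝ) (hg0 : ∀ x, 0 ≤ g x)
    (hgmeas : Measurable g) (p : ℝ) (hp : 1 ≤ p) (y : EuclideanSpace ℝ (Fin n))
    (hi : Integrable fun v => |⟪v, y⟫| ^ p * g v) :
    MemLp (phi g p y) (ENNReal.ofReal p) := by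
  have hp0 : 0 < p := by linarith
  have hm : AEStronglyMeasurable (phi g p y) volume := by
    unfold phi; fun_prop
  rw [← integrable_norm_rpow_iff hm (by simpa using hp0) (by simp), ENNReal.toReal_ofReal hp0.le]
  refine (plus_integrable g hg0 hgmeas p hp y hi).congr (Filter.Eventually.of_forall fun v => ?_)
  have h0 : 0 ≤ max ⟪v, y⟫ 0 := le_max_right _ _
  have := hg0 v
  simp only [phi]
  rw [Real.norm_of_nonneg (by positivity), rpow_wt hp h0 (hg0 v)]

lemma phi_norm (g : EuclideanSpace ℝ (Fin n) → ℝ) (hg0 : ∀ x, 0 ≤ g x)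
    (hgmeas : Measurable g) (p : ℝ) (hp : 1 ≤ p) (y : EuclideanSpace ℝ (Fin n))
    (hi : Integrable fun v => |⟪v, y⟫| ^ p * g v) :
    (∫ v, (max ⟪v, y⟫ 0) ^ p * g v) ^ (1 / p) =
      (eLpNorm (phi g p y) (ENNReal.ofReal p) volume).toReal := by
  have hp0 : 0 < p := by linarith
  rw [(phi_memLp g hg0 hgmeas p hp y hi).eLpNorm_eq_integral_rpow_norm (by simpa using hp0)
    (by simp), ENNReal.toReal_ofReal hp0.le, ENNReal.toReal_ofReal (by positivity), one_div]
  congr 1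
  refine integral_congr_ae (Filter.Eventually.of_forall fun v => ?_)
  have h0 : 0 ≤ max ⟪v, y⟫ 0 := le_max_right _ _
  have := hg0 v
  simp only [phi]
  rw [Real.norm_of_nonneg (by positivity), rpow_wt hp h0 (hg0 v)]

/-- The support function of the one-sided body. -/
noncomputable def supp (g : EuclideanSpace ℝ (Fin n) → ℝ) (p : ℝ) (y : EuclideanSpace ℝ (Fin n)) :
    ℝ := (2 * ∫ v, (max ⟪v, y⟫ 0) ^ p * g v) ^ (1 / p)

lemma int_nonneg (g : EuclideanSpace ℝ (Fin n) → ℝ) (hg0 : ∀ x, 0 ≤ g x) (p : ℝ)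
    (y : EuclideanSpace ℝ (Fin n)) : 0 ≤ ∫ v, (max ⟪v, y⟫ 0) ^ p * g v :=
  integral_nonneg fun v => mul_nonneg (Real.rpow_nonneg (le_max_right _ _) _) (hg0 v)

lemma supp_nonneg (g : EuclideanSpace ℝ (Fin n) → ℝ) (hg0 : ∀ x, 0 ≤ g x) (p : ℝ)
    (y : EuclideanSpace ℝ (Fin n)) : 0 ≤ supp g p y :=
  Real.rpow_nonneg (mul_nonneg (by norm_num) (int_nonneg g hg0 p y)) _

lemma supp_smul (g : EuclideanSpace ℝ (Fin n) → ℝ) (hg0 : ∀ x, 0 ≤ g x) (p : ℝ) (hp : 1 ≤ p)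
    (c : ℝ) (hc : 0 < c) (y : EuclideanSpace ℝ (Fin n)) : supp g p (c • y) = c * supp g p y := by
  have h : ∀ v : EuclideanSpace ℝ (Fin n), (max ⟪v, c • y⟫ 0) ^ p * g v =
      c ^ p * ((max ⟪v, y⟫ 0) ^ p * g v) := by
    intro v
    rw [real_inner_smul_right, ← mul_assoc, ← Real.mul_rpow hc.le (le_max_right _ _),
      mul_max_of_nonneg _ _ hc.le, mul_zero]
  unfold supp
  simp_rw [h]
  rw [integral_const_mul, mul_left_comm, Real.mul_rpow (by positivity)
    (mul_nonneg (by norm_num) (int_nonneg g hg0 p y)), ← Real.rpow_mul hc.le,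
    mul_one_div_cancel (by positivity), Real.rpow_one]

lemma supp_add (g : EuclideanSpace ℝ (Fin n) → ℝ) (hg0 : ∀ x, 0 ≤ g x)
    (hgmeas : Measurable g) (p : ℝ) (hp : 1 ≤ p)
    (hi : ∀ y : EuclideanSpace ℝ (Fin n), Integrable fun v => |⟪v, y⟫| ^ p * g v)
    (y z : EuclideanSpace ℝ (Fin n)) : supp g p (y + z) ≤ supp g p y + supp g p z := by
  unfold supp
  rw [Real.mul_rpow (by norm_num) (int_nonneg g hg0 p _),
    Real.mul_rpow (by norm_num) (int_nonneg g hg0 p _),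
    Real.mul_rpow (by norm_num) (int_nonneg g hg0 p _), ← mul_add]
  refine mul_le_mul_of_nonneg_left ?_ (by positivity)
  rw [phi_norm g hg0 hgmeas p hp _ (hi _), phi_norm g hg0 hgmeas p hp _ (hi _),
    phi_norm g hg0 hgmeas p hp _ (hi _)]
  have my := phi_memLp g hg0 hgmeas p hp _ (hi y)
  have mz := phi_memLp g hg0 hgmeas p hp _ (hi z)
  rw [← ENNReal.toReal_add my.eLpNorm_ne_top mz.eLpNorm_ne_top]
  refine ENNReal.toReal_mono (ENNReal.add_ne_top.mpr ⟨my.eLpNorm_ne_top, mz.eLpNorm_ne_top⟩) ?_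
  refine le_trans ?_ (eLpNorm_add_le my.1 mz.1 (by simpa using hp))
  refine eLpNorm_mono_real fun v => ?_
  have h0 : 0 ≤ max ⟪v, y + z⟫ 0 := le_max_right _ _
  have := hg0 v
  simp only [phi, Pi.add_apply]
  rw [Real.norm_of_nonneg (by positivity), ← add_mul]
  gcongr
  rw [inner_add_right]
  exact max_le (add_le_add (le_max_left _ _) (le_max_left _ _))
    (add_nonneg (le_max_right _ _) (le_max_right _ _))

lemma supp_pair (g : EuclideanSpace ℝ (Fin n) → ℝ) (hg0 : ∀ x, 0 ≤ g x)
    (hgmeas : Measurable g) (p : ℝ) (hp : 1 ≤ p)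
    (hi : ∀ y : EuclideanSpace ℝ (Fin n), Integrable fun v => |⟪v, y⟫| ^ p * g v)
    (y : EuclideanSpace ℝ (Fin n)) :
    (2 : ℝ) ^ (1 / p) * (∫ v, |⟪v, y⟫| ^ p * g v) ^ (1 / p) ≤ supp g p y + supp g p (-y) := by
  have hp0 : 0 < p := by linarith
  have h : ∀ v : EuclideanSpace ℝ (Fin n), |⟪v, y⟫| ^ p * g v =
      (max ⟪v, y⟫ 0) ^ p * g v + (max ⟪v, -y⟫ 0) ^ p * g v := by
    intro v
    rw [← add_mul, inner_neg_right]
    congr 1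
    rcases le_total 0 ⟪v, y⟫ with h | h
    · rw [abs_of_nonneg h, max_eq_left h, max_eq_right (by linarith), Real.zero_rpow hp0.ne',
        add_zero]
    · rw [abs_of_nonpos h, max_eq_right h, max_eq_left (by linarith), Real.zero_rpow hp0.ne',
        zero_add]
  have h2 : ∫ v, |⟪v, y⟫| ^ p * g v =
      (∫ v, (max ⟪v, y⟫ 0) ^ p * g v) + ∫ v, (max ⟪v, -y⟫ 0) ^ p * g v := by
    simp_rw [h]
    exact integral_add (plus_integrable g hg0 hgmeas p hp _ (hi _))
      (plus_integrable g hg0 hgmeas p hp _ (hi _))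
  have ha := int_nonneg g hg0 p y
  have hb := int_nonneg g hg0 p (-y)
  unfold supp
  rw [h2, ← Real.mul_rpow (by norm_num) (add_nonneg ha hb), mul_add]
  exact Real.rpow_add_le_add_rpow (by positivity) (by positivity) (by positivity)
    (by rw [div_le_one hp0]; exact hp)

lemma null_case (g : EuclideanSpace ℝ (Fin n) → ℝ) (p : ℝ) (hp : 1 ≤ p)
    (y : EuclideanSpace ℝ (Fin n)) (hi : ¬ Integrable fun v => |⟪v, y⟫| ^ p * g v) :
    volume (ZpBody g p) = 0 := by
  have hp0 : 0 < p := by linarith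
  have hy : y ≠ 0 := by
    rintro rfl
    apply hi
    simp [Real.zero_rpow hp0.ne']
  have hne : (ℝ ∙ y)ᗮ ≠ ⊤ := by
    intro h
    have : y ∈ (ℝ ∙ y)ᗮ := h ▸ Submodule.mem_top
    rw [Submodule.mem_orthogonal_singleton_iff_inner_right, inner_self_eq_zero] at this
    exact hy this
  refine measure_mono_null (fun x hx => ?_) (Measure.addHaar_submodule volume _ hne)
  have h1 := hx y
  have h2 := hx (-y)
  simp only [inner_neg_right, abs_neg] at h2
  rw [integral_undef hi, Real.zero_rpow (by positivity)] at h1 h2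
  rw [SetLike.mem_coe, Submodule.mem_orthogonal_singleton_iff_inner_left]
  linarith

lemma first_part (g : EuclideanSpace ℝ (Fin n) → ℝ) (hg0 : ∀ x, 0 ≤ g x)
    (hgmeas : Measurable g) (p : ℝ) (hp : 1 ≤ p)
    (hi : ∀ y : EuclideanSpace ℝ (Fin n), Integrable fun v => |⟪v, y⟫| ^ p * g v) :
    ENNReal.ofReal ((2 : ℝ) ^ ((n : ℝ) / p) * (4 : ℝ) ^ (-(n : ℝ))) * volume (ZpBody g p) ≤
      volume (ZpPlusBody g p) := by
  have hK : ZpPlusBody g p = body (supp g p) := rfl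
  have hsub : ((2 : ℝ) ^ (1 / p)) • ZpBody g p ⊆ ZpPlusBody g p - ZpPlusBody g p := by
    rintro _ ⟨x, hx, rfl⟩
    rw [hK]
    refine body_sub _ (supp_smul g hg0 p hp) (supp_add g hg0 hgmeas p hp hi)
      (supp_nonneg g hg0 p) _ fun y => ?_
    refine le_trans ?_ (supp_pair g hg0 hgmeas p hp hi y)
    simp only [real_inner_smul_left]
    exact mul_le_mul_of_nonneg_left (hx y) (by positivity)
  have hRS := rogers_shephard (body_convex (supp g p)) (body_compact _)
    (fun y => by simpa using supp_nonneg g hg0 p y)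
  rw [← hK] at hRS
  refine le_trans ?_ hRS
  refine le_trans (le_of_eq ?_) (mul_le_mul_right (measure_mono hsub) _)
  rw [Measure.addHaar_smul, ← mul_assoc, ← ENNReal.ofReal_mul (by positivity),
    finrank_euclideanSpace_fin, abs_of_nonneg (by positivity)]
  congr 2
  rw [mul_comm, Real.rpow_neg (by norm_num), Real.rpow_natCast, one_div, inv_pow,
    ← Real.rpow_mul_natCast (by norm_num)]
  congr 2
  ring

end ZpAux

/-- For a random vector with density `g` on `ℝⁿ` and `p ≥ 1`:
`vol(Z_p⁺) ≥ 2^{n/p} 4^{−n} vol(Z_p)`, and consequently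
`vr(Z_p⁺) ≥ (1/4) 2^{1/p} vr(Z_p)`. -/
theorem ZpPlus_volume_lower_bound
    {n : ℕ} (g : EuclideanSpace ℝ (Fin n) → ℝ) (hg0 : ∀ x, 0 ≤ g x)
    (hgmeas : Measurable g) (hgint : ∫ v, g v = 1)
    (p : ℝ) (hp : 1 ≤ p) :
    ENNReal.ofReal ((2 : ℝ) ^ ((n : ℝ) / p) * (4 : ℝ) ^ (-(n : ℝ))) * volume (ZpBody g p) ≤
      volume (ZpPlusBody g p) ∧
    (1 / 4) * (2 : ℝ) ^ (1 / p) *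
        ((volume (ZpBody g p)).toReal /
          (volume (Metric.closedBall (0 : EuclideanSpace ℝ (Fin n)) 1)).toReal) ^ ((1 : ℝ) / n) ≤
      ((volume (ZpPlusBody g p)).toReal /
        (volume (Metric.closedBall (0 : EuclideanSpace ℝ (Fin n)) 1)).toReal) ^ ((1 : ℝ) / n) := by
  have hp0 : 0 < p := by linarith
  have hc4 : (1 / 4) * (2 : ℝ) ^ (1 / p) ≤ 1 := by
    have : (2 : ℝ) ^ (1 / p) ≤ 2 ^ (1 : ℝ) :=
      Real.rpow_le_rpow_of_exponent_le (by norm_num) (by rw [div_le_one hp0]; exact hp)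
    rw [Real.rpow_one] at this
    linarith
  have hn0 : n = 0 → (1 / 4) * (2 : ℝ) ^ (1 / p) *
        ((volume (ZpBody g p)).toReal /
          (volume (Metric.closedBall (0 : EuclideanSpace ℝ (Fin n)) 1)).toReal) ^ ((1 : ℝ) / n) ≤
      ((volume (ZpPlusBody g p)).toReal /
        (volume (Metric.closedBall (0 : EuclideanSpace ℝ (Fin n)) 1)).toReal) ^ ((1 : ℝ) / n) := by
    intro h
    have h' : (1 : ℝ) / n = 0 := by simp [h]
    rw [h', Real.rpow_zero, Real.rpow_zero, mul_one]
    exact hc4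
  by_cases hi : ∀ y : EuclideanSpace ℝ (Fin n), Integrable fun v => |⟪v, y⟫| ^ p * g v
  · have h1 := ZpAux.first_part g hg0 hgmeas p hp hi
    refine ⟨h1, ?_⟩
    by_cases hn : n = 0
    · exact hn0 hn
    have hfin : volume (ZpPlusBody g p) ≠ ⊤ :=
      (ZpAux.body_compact (ZpAux.supp g p)).measure_lt_top.ne
    have h2 := ENNReal.toReal_mono hfin h1
    rw [ENNReal.toReal_mul, ENNReal.toReal_ofReal (by positivity)] at h2
    set B := (volume (Metric.closedBall (0 : EuclideanSpace ℝ (Fin n)) 1)).toReal with hB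
    set V := (volume (ZpBody g p)).toReal with hV
    have hB0 : 0 ≤ B := ENNReal.toReal_nonneg
    have hV0 : 0 ≤ V := ENNReal.toReal_nonneg
    have h3 : (2 : ℝ) ^ ((n : ℝ) / p) * (4 : ℝ) ^ (-(n : ℝ)) = ((1 / 4) * (2 : ℝ) ^ (1 / p)) ^ n := by
      rw [mul_comm, mul_pow, Real.rpow_neg (by norm_num), Real.rpow_natCast, one_div, inv_pow,
        ← Real.rpow_mul_natCast (by norm_num)]
      congr 2
      ring
    rw [h3] at h2
    have hc0 : 0 ≤ (1 / 4) * (2 : ℝ) ^ (1 / p) := by positivity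
    set c := (1 / 4) * (2 : ℝ) ^ (1 / p) with hc
    have h4 : c * (V / B) ^ ((1 : ℝ) / n) = (c ^ n * V / B) ^ ((1 : ℝ) / n) := by
      rw [mul_div_assoc, Real.mul_rpow (by positivity) (by positivity), one_div,
        Real.pow_rpow_inv_natCast hc0 hn]
    rw [h4]
    exact Real.rpow_le_rpow (by positivity) (by gcongr) (by positivity)
  · push Not at hi
    obtain ⟨y, hy⟩ := hi
    have h0 := ZpAux.null_case g p hp y hy
    refine ⟨by simp [h0], ?_⟩
    by_cases hn : n = 0
    · exact hn0 hn
    have hn' : (1 : ℝ) / n ≠ 0 := by simpa using hn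
    rw [h0, ENNReal.toReal_zero, zero_div, Real.zero_rpow hn', mul_zero]
    positivity
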